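/- In the Curie–Weiss voting model with coupling 0 < J < 1, i.e., the probability measure on {-1,1}^N proportional to exp((J/(2N))·(Σ_{i=1}^N X_i)²), the expectation E_{J,N}[|Σ_{i=1}^N X_i|] satisfies E_{J,N}[|Σ X_i|]/√N → √(2/π)·(1/√(1-J)) as N → ∞. -/

import Mathlib

open MeasureTheory Filter

open ProbabilityTheory

lemma cw_ui (μs : ℕ → ProbabilityMeasure ℝ) (μ : ProbabilityMeasure ℝ)
    (h : Tendsto μs atTop (nhds μ)) (g W : ℝ → ℝ) (hgc : Continuous g) 
    (hg0 : ∀ x, 0 ≤ g x) (C : ℝ)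
    (hWi : ∀ n, Integrable W (μs n : Measure ℝ)) (hWC : ∀ n, ∫ x, W x ∂(μs n : Measure ℝ) ≤ C)
    (hWi' : Integrable W (μ : Measure ℝ)) (hWC' : ∫ x, W x ∂(μ : Measure ℝ) ≤ C)
    (hg : ∀ ε > 0, ∃ M, 0 ≤ M ∧ ∀ x, g x ≤ min (g x) M + ε * W x) :
    Tendsto (fun n => ∫ x, g x ∂(μs n : Measure ℝ)) atTop (nhds (∫ x, g x ∂(μ : Measure ℝ))) := by
  have key : ∀ (ν : ProbabilityMeasure ℝ), Integrable W (ν : Measure ℝ) →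
      ∫ x, W x ∂(ν : Measure ℝ) ≤ C → ∀ δ > 0, ∀ M, 0 ≤ M → 
      (∀ x, g x ≤ min (g x) M + δ * W x) → 
      |∫ x, g x ∂(ν : Measure ℝ) - ∫ x, min (g x) M ∂(ν : Measure ℝ)| ≤ δ * C := by
    intro ν hi hC δ hδ M hM hb
    have hmi : Integrable (fun x => min (g x) M) (ν : Measure ℝ) := by
      refine (integrable_const M).mono' (hgc.min continuous_const).aestronglyMeasurable ?_
      refine Eventually.of_forall fun x => ?_
      rw [Real.norm_of_nonneg (le_min (hg0 x) hM)]
      exact min_le_right _ _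
    have hgi : Integrable g (ν : Measure ℝ) := by
      refine (hmi.add (hi.const_mul δ)).mono' hgc.aestronglyMeasurable ?_
      refine Eventually.of_forall fun x => ?_
      rw [Real.norm_of_nonneg (hg0 x)]
      exact hb x
    rw [← integral_sub hgi hmi, abs_of_nonneg (integral_nonneg fun x => sub_nonneg.2 (min_le_left _ _))]
    calc _ ≤ ∫ x, δ * W x ∂(ν : Measure ℝ) := by
          refine integral_mono (hgi.sub hmi) (hi.const_mul δ) fun x => ?_
          have := hb x
          simp only [Pi.sub_apply]
          linarith
      _ ≤ _ := by rw [integral_const_mul]; gcongr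
  rw [Metric.tendsto_nhds]
  intro ε hε
  set δ := ε / (3 * (|C| + 1)) with hδ
  have hδ0 : 0 < δ := by positivity
  have hδC : δ * C < ε / 3 := by
    have : δ * (|C| + 1) = ε / 3 := by rw [hδ]; field_simp
    nlinarith [le_abs_self C]
  obtain ⟨M, hM, hb⟩ := hg δ hδ0
  have hbc : ∃ F : BoundedContinuousFunction ℝ ℝ, ∀ x, F x = min (g x) M := by
    refine ⟨BoundedContinuousFunction.ofNormedAddCommGroup (fun x => min (g x) M)
      (hgc.min continuous_const) M fun x => ?_, fun x => rfl⟩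
    rw [Real.norm_of_nonneg (le_min (hg0 x) hM)]
    exact min_le_right _ _
  obtain ⟨F, hF⟩ := hbc
  have hT := (ProbabilityMeasure.tendsto_iff_forall_integral_tendsto.1 h) F
  simp only [hF] at hT
  filter_upwards [Metric.tendsto_nhds.1 hT (ε/3) (by positivity)] with n hn
  have h1 := key (μs n) (hWi n) (hWC n) δ hδ0 M hM hb
  have h2 := key μ hWi' hWC' δ hδ0 M hM hb
  rw [Real.dist_eq] at *
  rw [abs_le] at h1 h2
  rw [abs_lt] at *
  constructor <;> linarith [h1.1, h1.2, h2.1, h2.2, hn.1, hn.2]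

lemma cw_dom (J a : ℝ) (hJ0 : 0 < J) (ha : J < a) (g : ℝ → ℝ)
    (hg : ∀ x, g x ≤ (1 + |x|) * Real.exp (J * x ^ 2 / 2)) :
    ∀ ε > 0, ∃ M, 0 ≤ M ∧ ∀ x, g x ≤ min (g x) M + ε * Real.exp (a * x ^ 2 / 2) := by
  intro ε hε
  set c := (a - J) / 2 with hc
  have hc0 : 0 < c := by rw [hc]; linarith
  set R := max 1 (2 / (ε * c)) with hR
  have hR1 : 1 ≤ R := le_max_left _ _
  refine ⟨(1 + R) * Real.exp (J * R ^ 2 / 2), by positivity, fun x => ?_⟩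
  rcases le_total |x| R with hx | hx
  · have h1 : g x ≤ (1 + R) * Real.exp (J * R ^ 2 / 2) := by
      refine (hg x).trans ?_
      have : x ^ 2 ≤ R ^ 2 := by rw [← sq_abs]; gcongr
      gcongr
    rw [min_eq_left h1]
    have := Real.exp_pos (a * x ^ 2 / 2)
    nlinarith
  · have hm : 0 ≤ (1 + R) * Real.exp (J * R ^ 2 / 2) := by positivity
    have h2 : (1 + |x|) ≤ ε * Real.exp (c * x ^ 2) := by
      have h3 := Real.add_one_le_exp (c * x ^ 2)
      have h4 : 2 / (ε * c) ≤ |x| := (le_max_right _ _).trans hx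
      rw [div_le_iff₀ (by positivity)] at h4
      have h5 : 2 * |x| ≤ ε * c * x ^ 2 := by rw [← sq_abs x]; nlinarith [abs_nonneg x]
      nlinarith
    have h6 : g x ≤ ε * Real.exp (a * x ^ 2 / 2) := by
      refine (hg x).trans ?_
      have : Real.exp (a * x ^ 2 / 2) = Real.exp (c * x ^ 2) * Real.exp (J * x ^ 2 / 2) := by
        rw [← Real.exp_add, hc]; congr 1; ring
      rw [this, ← mul_assoc]
      gcongr
    rcases le_total (g x) ((1 + R) * Real.exp (J * R ^ 2 / 2)) with h7 | h7
    · rw [min_eq_left h7]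
      have := Real.exp_pos (a * x ^ 2 / 2)
      nlinarith
    · rw [min_eq_right h7]; linarith

noncomputable def cwS (N : ℕ) (σ : Fin N → Bool) : ℝ := ∑ i, if σ i then (1 : ℝ) else -1

noncomputable def cwU (N : ℕ) : Measure (Fin N → Bool) :=
  (PMF.uniformOfFintype (Fin N → Bool)).toMeasure

instance (N : ℕ) : IsProbabilityMeasure (cwU N) := by unfold cwU; infer_instance

noncomputable def cwMu (N : ℕ) : ProbabilityMeasure ℝ :=
  ⟨(cwU N).map (fun σ => cwS N σ / Real.sqrt N), 
    Measure.isProbabilityMeasure_map (measurable_of_finite _).aemeasurable⟩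

lemma cw_int {E : Type*} [NormedAddCommGroup E] [NormedSpace ℝ E] [CompleteSpace E] (N : ℕ) (f : ℝ → E) (hf : Continuous f) :
    ∫ x, f x ∂(cwMu N : Measure ℝ) = ((2:ℝ) ^ N)⁻¹ • ∑ σ, f (cwS N σ / Real.sqrt N) := by
  change ∫ x, f x ∂((cwU N).map (fun σ => cwS N σ / Real.sqrt N)) = _
  rw [integral_map (measurable_of_finite _).aemeasurable]
  · unfold cwU
    rw [PMF.integral_eq_sum, Finset.smul_sum]
    simp
  · exact (hf.stronglyMeasurable).aestronglyMeasurable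

lemma cw_integrable (N : ℕ) (f : ℝ → ℝ) (hf : Continuous f) :
    Integrable f (cwMu N : Measure ℝ) := by
  change Integrable f ((cwU N).map (fun σ => cwS N σ / Real.sqrt N))
  rw [integrable_map_measure (hf.stronglyMeasurable).aestronglyMeasurable (measurable_of_finite _).aemeasurable]
  exact Integrable.of_finite

lemma cw_sumC (N : ℕ) (z : ℂ) :
    ∑ σ, Complex.exp (z * cwS N σ) = (Complex.exp z + Complex.exp (-z)) ^ N := by
  have := Finset.prod_univ_sum (fun _ : Fin N => (Finset.univ : Finset Bool))
    (fun _ b => Complex.exp (z * (if b then (1:ℝ) else -1 : ℝ)))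
  simp only [Fintype.piFinset_univ] at this
  rw [show (Complex.exp z + Complex.exp (-z)) ^ N = ∏ i : Fin N, ∑ j : Bool, Complex.exp (z * (if j then (1:ℝ) else -1 : ℝ)) by simp, this]
  refine Finset.sum_congr rfl fun σ _ => ?_
  rw [← Complex.exp_sum, ← Finset.mul_sum]
  congr 2
  simp only [cwS, Complex.ofReal_sum]

lemma cw_sumR (N : ℕ) (z : ℝ) :
    ∑ σ, Real.exp (z * cwS N σ) = (2 * Real.cosh z) ^ N := by
  have := cw_sumC N z
  rw [Real.cosh_eq, mul_div_cancel₀ _ two_ne_zero]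
  exact_mod_cast this

lemma cw_clt : Tendsto cwMu atTop (nhds (⟨gaussianReal 0 1, inferInstance⟩ : ProbabilityMeasure ℝ)) := by
  refine ProbabilityMeasure.tendsto_iff_tendsto_charFun.2 fun t ↦ ?_
  have h1 : ∀ N, charFun (cwMu N : Measure ℝ) t = ((Real.cos (t / Real.sqrt N) ^ N : ℝ) : ℂ) := by
    intro N
    rw [charFun_apply_real, cw_int N _ (by fun_prop)]
    have : ∀ σ, Complex.exp (t * ((cwS N σ / Real.sqrt N : ℝ) : ℂ) * Complex.I)
        = Complex.exp (((t / Real.sqrt N : ℝ) * Complex.I) * cwS N σ) := by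
      intro σ; congr 1; push_cast; ring
    simp only [this]
    rw [cw_sumC]
    rw [Complex.real_smul]
    push_cast
    rw [← neg_mul, Complex.cos, ← inv_pow, ← mul_pow]
    congr 1
    ring
  simp only [h1]
  have h2 : charFun (gaussianReal 0 1) t = ((Real.exp (- t ^ 2 / 2) : ℝ) : ℂ) := by
    rw [charFun_gaussianReal]; push_cast; congr 1; simp; ring
  change Tendsto _ _ (nhds (charFun (gaussianReal 0 1) t))
  rw [h2]
  refine (Complex.continuous_ofReal.tendsto _).comp ?_
  have h3 : Tendsto (fun N : ℕ => (N:ℝ) * (Real.cos (t / Real.sqrt N) - 1)) atTop (nhds (- t ^ 2 / 2)) := by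
    rw [tendsto_iff_norm_sub_tendsto_zero]
    refine squeeze_zero' (g := fun N : ℕ => t ^ 4 * (5/96) / (N:ℝ)) (Eventually.of_forall fun _ => norm_nonneg _) ?_ (tendsto_const_div_atTop_nhds_zero_nat _)
    filter_upwards [eventually_gt_atTop 0, eventually_ge_atTop (Nat.ceil (t^2))] with N hN hN2
    have hN' : (0:ℝ) < N := by exact_mod_cast hN
    have hN2' : t ^ 2 ≤ N := Nat.ceil_le.1 hN2
    have hs : Real.sqrt N ^ 2 = N := Real.sq_sqrt hN'.le
    have hs0 : 0 < Real.sqrt N := Real.sqrt_pos.2 hN'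
    have hx : |t / Real.sqrt N| ≤ 1 := by
      rw [abs_div, abs_of_pos hs0, div_le_one hs0]
      exact Real.abs_le_sqrt hN2'
    have hb := Real.cos_bound hx
    have e2 : (t / Real.sqrt N) ^ 2 = t ^ 2 / N := by rw [div_pow, hs]
    have e4 : |t / Real.sqrt N| ^ 4 = t ^ 4 / N ^ 2 := by
      rw [show |t / Real.sqrt N| ^ 4 = (|t / Real.sqrt N| ^ 2) ^ 2 by ring, sq_abs, e2]; ring
    rw [e2, e4] at hb
    have : (N:ℝ) * (Real.cos (t / Real.sqrt N) - 1) - -t ^ 2 / 2 = N * (Real.cos (t / Real.sqrt N) - (1 - t ^ 2 / N / 2)) := by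
      field_simp; ring
    rw [this, norm_mul, Real.norm_of_nonneg hN'.le, Real.norm_eq_abs]
    calc _ ≤ (N:ℝ) * (t ^ 4 / N ^ 2 * (5/96)) := by gcongr
      _ = _ := by field_simp
  have h4 := Real.tendsto_one_add_pow_exp_of_tendsto h3
  simpa using h4

lemma cw_pdf (x : ℝ) : gaussianPDFReal 0 1 x = (Real.sqrt (2 * Real.pi))⁻¹ * Real.exp (-(x^2)/2) := by
  simp [gaussianPDFReal]

lemma cw_gint (a : ℝ) (ha : a < 1) :
    Integrable (fun x => Real.exp (a * x ^ 2 / 2)) (gaussianReal 0 1) := by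
  rw [gaussianReal_of_var_ne_zero _ one_ne_zero, gaussianPDF_def]
  rw [integrable_withDensity_iff_integrable_smul₀' (by fun_prop) (by simp)]
  have : ∀ x : ℝ, (ENNReal.ofReal (gaussianPDFReal 0 1 x)).toReal • Real.exp (a * x ^ 2 / 2)
     = (Real.sqrt (2 * Real.pi))⁻¹ * Real.exp (-((1 - a) / 2) * x ^ 2) := by
    intro x
    rw [ENNReal.toReal_ofReal (gaussianPDFReal_nonneg _ _ _), cw_pdf, smul_eq_mul, mul_assoc, ← Real.exp_add]
    congr 2; ring
  simp only [this]
  exact (integrable_exp_neg_mul_sq (by linarith)).const_mul _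

lemma cw_den (a : ℝ) (ha : a < 1) :
    ∫ x, Real.exp (a * x ^ 2 / 2) ∂(gaussianReal 0 1) = 1 / Real.sqrt (1 - a) := by
  rw [integral_gaussianReal_eq_integral_smul one_ne_zero]
  have : ∀ x : ℝ, (gaussianPDFReal 0 1 x) • Real.exp (a * x ^ 2 / 2)
     = (Real.sqrt (2 * Real.pi))⁻¹ * Real.exp (-((1 - a) / 2) * x ^ 2) := by
    intro x
    rw [cw_pdf, smul_eq_mul, mul_assoc, ← Real.exp_add]
    congr 2; ring
  simp only [this]
  rw [integral_const_mul, integral_gaussian]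
  have h1 : 0 < 1 - a := by linarith
  rw [show Real.pi / ((1 - a) / 2) = 2 * Real.pi / (1 - a) by field_simp, Real.sqrt_div (by positivity)]
  have : Real.sqrt (2 * Real.pi) ≠ 0 := by positivity
  field_simp

lemma cw_num (a : ℝ) (ha : a < 1) :
    ∫ x, |x| * Real.exp (a * x ^ 2 / 2) ∂(gaussianReal 0 1) = (Real.sqrt (2 * Real.pi))⁻¹ * (2 / (1 - a)) := by
  rw [integral_gaussianReal_eq_integral_smul one_ne_zero]
  have : ∀ x : ℝ, (gaussianPDFReal 0 1 x) • (|x| * Real.exp (a * x ^ 2 / 2))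
     = (Real.sqrt (2 * Real.pi))⁻¹ * (fun y => y * Real.exp (-((1 - a) / 2) * y ^ 2)) |x| := by
    intro x
    simp only [sq_abs]
    rw [cw_pdf, smul_eq_mul, show -((1 - a) / 2) * x ^ 2 = -(x^2)/2 + a * x ^ 2 / 2 by ring, Real.exp_add]
    ring
  simp only [this]
  rw [integral_const_mul, integral_comp_abs (f := fun y => y * Real.exp (-((1 - a) / 2) * y ^ 2))]
  have h1 : 0 < 1 - a := by linarith
  have h2 := integral_mul_cexp_neg_mul_sq (b := (((1 - a) / 2 : ℝ) : ℂ)) (by rw [Complex.ofReal_re]; linarith)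
  have h3 : ∫ y in Set.Ioi (0:ℝ), y * Real.exp (-((1 - a) / 2) * y ^ 2) = (2 * ((1 - a) / 2))⁻¹ := by
    have e : ∀ y : ℝ, (y:ℂ) * Complex.exp (-(((1 - a) / 2 : ℝ) : ℂ) * (y:ℂ) ^ 2) = ((y * Real.exp (-((1 - a) / 2) * y ^ 2) : ℝ) : ℂ) := by
      intro y; push_cast; rfl
    simp only [e] at h2
    rw [integral_complex_ofReal] at h2
    exact_mod_cast h2
  rw [h3]
  congr 1
  field_simp

lemma cw_W (a : ℝ) (ha0 : 0 < a) (ha : a < 1) (N : ℕ) :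
    ∫ x, Real.exp (a * x ^ 2 / 2) ∂(cwMu N : Measure ℝ) ≤ ∫ x, Real.exp (a * x ^ 2 / 2) ∂(gaussianReal 0 1) := by
  have hs : ∀ x : ℝ, Real.exp (a * x ^ 2 / 2) = ∫ z, Real.exp (Real.sqrt a * x * z) ∂(gaussianReal 0 1) := by
    intro x
    have := congrFun (mgf_id_gaussianReal (μ := 0) (v := 1)) (Real.sqrt a * x)
    simp only [mgf, id] at this
    rw [this, mul_pow, Real.sq_sqrt ha0.le]
    simp
  rw [cw_int N _ (by fun_prop)]
  have : ∀ σ, Real.exp (a * (cwS N σ / Real.sqrt N) ^ 2 / 2) = ∫ z, Real.exp ((Real.sqrt a * z / Real.sqrt N) * cwS N σ) ∂(gaussianReal 0 1) := by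
    intro σ
    rw [hs]
    congr 1; ext z; congr 1; ring
  simp only [this]
  rw [← integral_finsetSum]
  swap
  · intro σ _
    have := integrable_exp_mul_gaussianReal (μ := 0) (v := 1) (Real.sqrt a / Real.sqrt N * cwS N σ)
    refine this.congr (Eventually.of_forall fun z => ?_)
    simp only; congr 1; ring
  simp only [cw_sumR]
  rw [smul_eq_mul, ← integral_const_mul]
  refine integral_mono_of_nonneg (Eventually.of_forall fun z => ?_) (cw_gint a ha) (Eventually.of_forall fun z => ?_)
  · have := Real.cosh_pos (Real.sqrt a * z / Real.sqrt N)
    simp only [Pi.zero_apply]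
    positivity
  · simp only
    rw [mul_pow, ← mul_assoc, inv_mul_cancel₀ (by positivity), one_mul]
    rcases Nat.eq_zero_or_pos N with h0 | h0
    · subst h0
      simp only [pow_zero]
      exact Real.one_le_exp (by positivity)
    · have hN : (0:ℝ) < N := by exact_mod_cast h0
      calc _ ≤ (Real.exp ((Real.sqrt a * z / Real.sqrt N) ^ 2 / 2)) ^ N := by
            have := Real.cosh_pos (Real.sqrt a * z / Real.sqrt N)
            gcongr
            exact Real.cosh_le_exp_half_sq _
        _ = _ := by
            rw [← Real.exp_nat_mul, div_pow, mul_pow, Real.sq_sqrt ha0.le, Real.sq_sqrt hN.le]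
            congr 1
            field_simp

lemma cw_lim (J : ℝ) (hJ0 : 0 < J) (hJ1 : J < 1) (g : ℝ → ℝ) (hc : Continuous g) (h0 : ∀ x, 0 ≤ g x)
    (hg : ∀ x, g x ≤ (1 + |x|) * Real.exp (J * x ^ 2 / 2)) :
    Tendsto (fun N => ∫ x, g x ∂(cwMu N : Measure ℝ)) atTop (nhds (∫ x, g x ∂(gaussianReal 0 1))) := by
  have ha0 : 0 < (1 + J) / 2 := by linarith
  have ha1 : (1 + J) / 2 < 1 := by linarith
  exact cw_ui cwMu ⟨gaussianReal 0 1, inferInstance⟩ cw_clt g (fun x => Real.exp ((1 + J) / 2 * x ^ 2 / 2)) hc h0 _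
    (fun n => cw_integrable n _ (by fun_prop)) (cw_W _ ha0 ha1) (cw_gint _ ha1) le_rfl
    (cw_dom J _ hJ0 (by linarith) g hg)

lemma cw_P (N : ℕ) (Q : Measure (Fin N → ℝ)) [IsProbabilityMeasure Q] (w : (Fin N → Bool) → ℝ)
    (hw : ∀ σ, 0 < w σ)
    (hQ : ∀ σ : Fin N → Bool, (Q {fun i => if σ i then (1 : ℝ) else -1}).toReal = w σ / ∑ τ, w τ) :
    ∫ x, |∑ i, x i| ∂Q = (∑ σ, |cwS N σ| * w σ) / ∑ τ, w τ := by
  classical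
  set v : (Fin N → Bool) → (Fin N → ℝ) := fun σ i => if σ i then (1 : ℝ) else -1 with hv
  have hinj : Function.Injective v := by
    intro σ τ h
    ext i
    have := congrFun h i
    simp only [hv] at this
    cases h1 : σ i <;> cases h2 : τ i <;> simp [h1, h2] at this ⊢ <;> norm_num at this
  set A : Finset (Fin N → ℝ) := Finset.univ.image v with hA
  have hpos : 0 < ∑ τ, w τ := Finset.sum_pos (fun σ _ => hw σ) Finset.univ_nonempty
  have hQA : Q.real (A : Set (Fin N → ℝ)) = 1 := by
    rw [← sum_measureReal_singleton, hA, Finset.sum_image (fun _ _ _ _ h => hinj h)]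
    simp only [Measure.real]
    rw [Finset.sum_congr rfl fun σ _ => hQ σ, ← Finset.sum_div, div_self hpos.ne']
  have hQA' : Q (A : Set (Fin N → ℝ)) = 1 := by
    rw [Measure.real] at hQA
    rw [← ENNReal.ofReal_toReal (measure_ne_top Q _), hQA, ENNReal.ofReal_one]
  have hae : (A : Set (Fin N → ℝ)) =ᵐ[Q] Set.univ := by
    rw [ae_eq_univ]
    exact (prob_compl_eq_zero_iff A.measurableSet).2 hQA'
  rw [← setIntegral_univ, ← setIntegral_congr_set hae]
  rw [setIntegral_finset]
  · rw [hA, Finset.sum_image (fun _ _ _ _ h => hinj h), Finset.sum_div]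
    refine Finset.sum_congr rfl fun σ _ => ?_
    rw [Measure.real, hQ σ, smul_eq_mul]
    simp only [cwS, hv]
    ring
  · exact IntegrableOn.finset

theorem curie_weiss_subcritical_margin
    (J : ℝ) (hJ0 : 0 < J) (hJ1 : J < 1)
    (P : (N : ℕ) → Measure (Fin N → ℝ)) [∀ N, IsProbabilityMeasure (P N)]
    (hP : ∀ N : ℕ, ∀ σ : Fin N → Bool,
      ((P N) {fun i => if σ i then (1 : ℝ) else -1}).toReal
        = Real.exp (J / (2 * N) * (∑ i, if σ i then (1 : ℝ) else -1) ^ 2)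
          / ∑ τ : Fin N → Bool,
              Real.exp (J / (2 * N) * (∑ i, if τ i then (1 : ℝ) else -1) ^ 2)) :
    Tendsto (fun N : ℕ => (∫ x, |∑ i, x i| ∂(P N)) / Real.sqrt N)
      atTop (nhds (Real.sqrt (2 / Real.pi) * (1 / Real.sqrt (1 - J)))) := by
  have hn := cw_lim J hJ0 hJ1 (fun x => |x| * Real.exp (J * x ^ 2 / 2)) (by fun_prop) (fun x => by positivity)
    (fun x => by gcongr; linarith)
  have hd := cw_lim J hJ0 hJ1 (fun x => Real.exp (J * x ^ 2 / 2)) (by fun_prop) (fun x => by positivity)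
    (fun x => le_mul_of_one_le_left (by positivity) (by linarith [abs_nonneg x]))
  rw [cw_num J hJ1] at hn
  rw [cw_den J hJ1] at hd
  have h1 : 0 < 1 - J := by linarith
  have h := hn.div hd (by positivity)
  have hlim : (Real.sqrt (2 * Real.pi))⁻¹ * (2 / (1 - J)) / (1 / Real.sqrt (1 - J)) = 
      Real.sqrt (2 / Real.pi) * (1 / Real.sqrt (1 - J)) := by
    have hs : Real.sqrt (1 - J) ^ 2 = 1 - J := Real.sq_sqrt h1.le
    have hs2 : Real.sqrt 2 ^ 2 = 2 := Real.sq_sqrt zero_le_two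
    rw [Real.sqrt_div zero_le_two, Real.sqrt_mul zero_le_two]
    have hsp : 0 < Real.sqrt (1 - J) := Real.sqrt_pos.2 h1
    have e1 : 2 / (1 - J) = 2 / Real.sqrt (1 - J) ^ 2 := by rw [hs]
    rw [e1]
    field_simp
    rw [hs2]
  rw [hlim] at h
  refine h.congr' ?_
  filter_upwards [eventually_gt_atTop 0] with N hN
  have hN' : (0:ℝ) < N := by exact_mod_cast hN
  have hs0 : 0 < Real.sqrt N := Real.sqrt_pos.2 hN'
  rw [cw_P N (P N) (fun σ => Real.exp (J / (2 * N) * cwS N σ ^ 2)) (fun σ => Real.exp_pos _) (hP N)]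
  simp only [Pi.div_apply]
  rw [cw_int N _ (by fun_prop), cw_int N _ (by fun_prop)]
  have e : ∀ σ, J * (cwS N σ / Real.sqrt N) ^ 2 / 2 = J / (2 * N) * cwS N σ ^ 2 := by
    intro σ; rw [div_pow, Real.sq_sqrt hN'.le]; field_simp
  simp only [e, smul_eq_mul]
  rw [mul_div_mul_left _ _ (by positivity), div_right_comm]
  congr 1
  rw [Finset.sum_div]
  refine Finset.sum_congr rfl fun σ _ => ?_
  rw [abs_div, abs_of_pos hs0]
  ring
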